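/- Fix α, β ∈ ℝ and constants g₀, λ, ρ₀ > 0. There exists S > 0 and unique continuous functions φ, ψ : (−∞, −S] → ℝ solving the integral equations φ(s) = −α + (1/3)∫_{−∞}^{s}(e^{2σ} − e^{−3s+5σ})(3φ² + e^{2σ}φ³ + g₀²e^{2σ}ψ²φ)dσ and ψ(s) = β + (1/2)∫_{−∞}^{s}(e^{2σ} − e^{−3s+5σ})(2(2φ + e^{2σ}φ²)ψ + λ(e^{2σ}ψ² − ρ₀²)ψ)dσ, with φ, ψ bounded; moreover φ(s) → −α and ψ(s) → β as s → −∞. -/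

import Mathlib

open Real Set Filter MeasureTheory

/-- Lipschitz on bounded sets, uniformly in the parameter `e ∈ [0,1]`. -/
def LipH (F : ℝ → ℝ → ℝ → ℝ) : Prop :=
  ∀ K : ℝ, ∃ L : ℝ, 0 ≤ L ∧ ∀ e x y x' y' : ℝ, 0 ≤ e → e ≤ 1 → |x| ≤ K → |y| ≤ K →
    |x'| ≤ K → |y'| ≤ K → |F e x y - F e x' y'| ≤ L * max |x - x'| |y - y'|

lemma lipH_of_contDiff (F : ℝ → ℝ → ℝ → ℝ)
    (hF : ContDiff ℝ 1 (fun p : ℝ × ℝ × ℝ => F p.1 p.2.1 p.2.2)) : LipH F := by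
  intro K
  have hc : IsCompact (Icc (0:ℝ) 1 ×ˢ (Icc (-K) K ×ˢ Icc (-K) K)) :=
    isCompact_Icc.prod (isCompact_Icc.prod isCompact_Icc)
  obtain ⟨L, hL⟩ := (hF.locallyLipschitz.locallyLipschitzOn
    (s := (Icc (0:ℝ) 1 ×ˢ (Icc (-K) K ×ˢ Icc (-K) K)))).exists_lipschitzOnWith_of_compact hc
  refine ⟨L, L.2, ?_⟩
  intro e x y x' y' h0 h1 hx hy hx' hy'
  have := hL.dist_le_mul (e, x, y) ⟨⟨h0, h1⟩, abs_le.1 hx, abs_le.1 hy⟩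
    (e, x', y') ⟨⟨h0, h1⟩, abs_le.1 hx', abs_le.1 hy'⟩
  simpa [Prod.dist_eq, Real.dist_eq] using this

lemma kern_bound (s σ : ℝ) (h : σ ≤ s) :
    |Real.exp (2 * σ) - Real.exp (-3 * s + 5 * σ)| ≤ Real.exp (2 * σ) := by
  have h1 : Real.exp (-3 * s + 5 * σ) ≤ Real.exp (2 * σ) := Real.exp_le_exp.2 (by linarith)
  have h2 := Real.exp_pos (-3 * s + 5 * σ)
  rw [abs_of_nonneg (by linarith)]
  linarith

lemma weight_int (C s : ℝ) (hC : 0 ≤ C) :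
    IntegrableOn (fun σ => Real.exp (2 * σ) * Real.exp (C * Real.exp (2 * σ))) (Iic s) ∧
    C * ∫ σ in Iic s, Real.exp (2 * σ) * Real.exp (C * Real.exp (2 * σ))
      ≤ (1 / 2) * Real.exp (C * Real.exp (2 * s)) := by
  have hint : IntegrableOn (fun σ => Real.exp (2 * σ) * Real.exp (C * Real.exp (2 * σ)))
      (Iic s) := by
    refine Integrable.mul_bdd (c := Real.exp (C * Real.exp (2 * s)))
      (integrableOn_exp_mul_Iic (by norm_num) s) ?_ ?_
    · exact (by fun_prop : Continuous fun σ => Real.exp (C * Real.exp (2 * σ))).aestronglyMeasurable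
    · refine (ae_restrict_iff' measurableSet_Iic).2 (Eventually.of_forall fun σ hσ => ?_)
      have : σ ≤ s := hσ
      rw [Real.norm_eq_abs, abs_of_pos (Real.exp_pos _)]
      gcongr
  refine ⟨hint, ?_⟩
  have hd : ∀ x ∈ Iic s, HasDerivAt (fun σ => (1/2) * Real.exp (C * Real.exp (2 * σ)))
      (C * (Real.exp (2 * x) * Real.exp (C * Real.exp (2 * x)))) x := by
    intro x _
    have h1 : HasDerivAt (fun σ : ℝ => 2 * σ) 2 x := by simpa using (hasDerivAt_id x).const_mul 2
    have := ((h1.exp.const_mul C).exp).const_mul (1/2 : ℝ)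
    exact this.congr_deriv (by ring)
  have ht : Tendsto (fun σ => (1/2) * Real.exp (C * Real.exp (2 * σ))) atBot
      (nhds ((1/2) * Real.exp (C * 0))) := by
    refine Tendsto.const_mul _ ((Real.continuous_exp.tendsto _).comp (Tendsto.const_mul _ ?_))
    exact Real.tendsto_exp_atBot.comp (tendsto_id.const_mul_atBot (by norm_num))
  have := integral_Iic_of_hasDerivAt_of_tendsto' hd (hint.const_mul C) ht
  rw [integral_const_mul] at this
  rw [this]
  have := Real.exp_pos (C * 0)
  linarith

/-- one step of the difference estimate -/
lemma diff_step (S : ℝ) (hS : 0 < S) (F : ℝ → ℝ → ℝ → ℝ)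
    (hFc : Continuous (fun p : ℝ × ℝ × ℝ => F p.1 p.2.1 p.2.2)) (hF0 : ∀ e, F e 0 0 = 0)
    (K L : ℝ) (hL : 0 ≤ L)
    (hLip : ∀ e x y x' y' : ℝ, 0 ≤ e → e ≤ 1 → |x| ≤ K → |y| ≤ K →
      |x'| ≤ K → |y'| ≤ K → |F e x y - F e x' y'| ≤ L * max |x - x'| |y - y'|)
    (C : ℝ) (hC : L ≤ C) (a c : ℝ) (hc : |c| ≤ 1) (φ₁ ψ₁ φ₂ ψ₂ : ℝ → ℝ)
    (hφ₁ : ContinuousOn φ₁ (Iic (-S))) (hψ₁ : ContinuousOn ψ₁ (Iic (-S)))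
    (hφ₂ : ContinuousOn φ₂ (Iic (-S))) (hψ₂ : ContinuousOn ψ₂ (Iic (-S)))
    (hb₁ : ∀ s ∈ Iic (-S), |φ₁ s| ≤ K ∧ |ψ₁ s| ≤ K)
    (hb₂ : ∀ s ∈ Iic (-S), |φ₂ s| ≤ K ∧ |ψ₂ s| ≤ K)
    (N : ℝ) (hN : ∀ s ∈ Iic (-S), max |φ₁ s - φ₂ s| |ψ₁ s - ψ₂ s|
      ≤ N * Real.exp (C * Real.exp (2 * s))) (s : ℝ) (hs : s ∈ Iic (-S)) :
    |(a + c * ∫ σ in Iic s, (Real.exp (2 * σ) - Real.exp (-3 * s + 5 * σ)) *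
        F (Real.exp (2 * σ)) (φ₁ σ) (ψ₁ σ)) -
      (a + c * ∫ σ in Iic s, (Real.exp (2 * σ) - Real.exp (-3 * s + 5 * σ)) *
        F (Real.exp (2 * σ)) (φ₂ σ) (ψ₂ σ))| ≤ N / 2 * Real.exp (C * Real.exp (2 * s)) := by
  have hs' : s ≤ -S := hs
  have hN0 : 0 ≤ N := by
    have h := (le_max_of_le_left (abs_nonneg _)).trans (hN s hs)
    exact nonneg_of_mul_nonneg_left h (Real.exp_pos _)
  have hK : 0 ≤ K := (abs_nonneg _).trans (hb₁ s hs).1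
  have hint : ∀ φ ψ : ℝ → ℝ, ContinuousOn φ (Iic (-S)) → ContinuousOn ψ (Iic (-S)) →
      (∀ s ∈ Iic (-S), |φ s| ≤ K ∧ |ψ s| ≤ K) →
      IntegrableOn (fun σ => (Real.exp (2 * σ) - Real.exp (-3 * s + 5 * σ)) *
        F (Real.exp (2 * σ)) (φ σ) (ψ σ)) (Iic s) := by
    intro φ ψ hφ hψ hb
    have hsub : Iic s ⊆ Iic (-S) := Iic_subset_Iic.2 hs'
    have hm : ContinuousOn (fun σ => (Real.exp (2 * σ) - Real.exp (-3 * s + 5 * σ)) *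
        F (Real.exp (2 * σ)) (φ σ) (ψ σ)) (Iic s) := by
      refine ContinuousOn.mul (by fun_prop) ?_
      exact hFc.comp_continuousOn (f := fun σ => (Real.exp (2 * σ), φ σ, ψ σ))
        ((by fun_prop : Continuous fun σ : ℝ => Real.exp (2 * σ)).continuousOn.prodMk
          ((hφ.mono hsub).prodMk (hψ.mono hsub)))
    refine Integrable.mono' (((integrableOn_exp_mul_Iic (a := 2) (by norm_num) s)).mul_const (L * K))
      (hm.aestronglyMeasurable measurableSet_Iic) ?_
    refine (ae_restrict_iff' measurableSet_Iic).2 (Eventually.of_forall fun σ hσ => ?_)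
    have hσ' : σ ≤ s := hσ
    have hbb := hb σ (hsub hσ)
    have h1 := hLip (Real.exp (2 * σ)) (φ σ) (ψ σ) 0 0 (Real.exp_pos _).le
      (Real.exp_le_one_iff.2 (by linarith)) hbb.1 hbb.2 (by simpa) (by simpa)
    rw [hF0] at h1
    simp only [sub_zero] at h1
    rw [Real.norm_eq_abs, abs_mul]
    refine mul_le_mul (kern_bound s σ hσ') (h1.trans ?_) (abs_nonneg _) (Real.exp_pos _).le
    exact mul_le_mul_of_nonneg_left (max_le hbb.1 hbb.2) hL
  have h1 := hint φ₁ ψ₁ hφ₁ hψ₁ hb₁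
  have h2 := hint φ₂ ψ₂ hφ₂ hψ₂ hb₂
  obtain ⟨w1, w2⟩ := weight_int C s (hL.trans hC)
  rw [add_sub_add_left_eq_sub, ← mul_sub, ← integral_sub h1 h2, abs_mul]
  have key : |∫ σ in Iic s, ((Real.exp (2 * σ) - Real.exp (-3 * s + 5 * σ)) *
        F (Real.exp (2 * σ)) (φ₁ σ) (ψ₁ σ) - (Real.exp (2 * σ) - Real.exp (-3 * s + 5 * σ)) *
        F (Real.exp (2 * σ)) (φ₂ σ) (ψ₂ σ))| ≤
      ∫ σ in Iic s, C * N * (Real.exp (2 * σ) * Real.exp (C * Real.exp (2 * σ))) := by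
    rw [← Real.norm_eq_abs]
    refine norm_integral_le_of_norm_le (w1.const_mul _) ?_
    refine (ae_restrict_iff' measurableSet_Iic).2 (Eventually.of_forall fun σ hσ => ?_)
    have hσ' : σ ≤ s := hσ
    have hσ'' : σ ∈ Iic (-S) := hσ'.trans hs'
    have hl := hLip (Real.exp (2 * σ)) (φ₁ σ) (ψ₁ σ) (φ₂ σ) (ψ₂ σ) (Real.exp_pos _).le
      (Real.exp_le_one_iff.2 (by linarith)) (hb₁ σ hσ'').1 (hb₁ σ hσ'').2
      (hb₂ σ hσ'').1 (hb₂ σ hσ'').2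
    rw [Real.norm_eq_abs, ← mul_sub, abs_mul]
    calc _ ≤ Real.exp (2 * σ) * (C * (N * Real.exp (C * Real.exp (2 * σ)))) := by
          refine mul_le_mul (kern_bound s σ hσ') (hl.trans ?_) (abs_nonneg _) (Real.exp_pos _).le
          exact mul_le_mul hC (hN σ hσ'') (le_max_of_le_left (abs_nonneg _)) (hL.trans hC)
      _ = _ := by ring
  rw [integral_const_mul] at key
  calc _ ≤ 1 * _ := mul_le_mul_of_nonneg_right hc (abs_nonneg _)
    _ ≤ 1 * _ := mul_le_mul_of_nonneg_left key zero_le_one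
    _ = N * (C * ∫ σ in Iic s, Real.exp (2 * σ) * Real.exp (C * Real.exp (2 * σ))) := by ring
    _ ≤ N * ((1 / 2) * Real.exp (C * Real.exp (2 * s))) := mul_le_mul_of_nonneg_left w2 hN0
    _ = _ := by ring

lemma uniq (S : ℝ) (hS : 0 < S) (F G : ℝ → ℝ → ℝ → ℝ)
    (hFc : Continuous (fun p : ℝ × ℝ × ℝ => F p.1 p.2.1 p.2.2)) (hF0 : ∀ e, F e 0 0 = 0)
    (hGc : Continuous (fun p : ℝ × ℝ × ℝ => G p.1 p.2.1 p.2.2)) (hG0 : ∀ e, G e 0 0 = 0)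
    (hF : LipH F) (hG : LipH G) (a b c d : ℝ) (hc : |c| ≤ 1) (hd : |d| ≤ 1)
    (φ₁ ψ₁ φ₂ ψ₂ : ℝ → ℝ)
    (hφ₁ : ContinuousOn φ₁ (Iic (-S))) (hψ₁ : ContinuousOn ψ₁ (Iic (-S)))
    (hb₁ : ∃ K : ℝ, ∀ s ∈ Iic (-S), |φ₁ s| ≤ K ∧ |ψ₁ s| ≤ K)
    (e₁ : ∀ s ∈ Iic (-S), φ₁ s = a + c * ∫ σ in Iic s,
      (Real.exp (2 * σ) - Real.exp (-3 * s + 5 * σ)) * F (Real.exp (2 * σ)) (φ₁ σ) (ψ₁ σ))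
    (f₁ : ∀ s ∈ Iic (-S), ψ₁ s = b + d * ∫ σ in Iic s,
      (Real.exp (2 * σ) - Real.exp (-3 * s + 5 * σ)) * G (Real.exp (2 * σ)) (φ₁ σ) (ψ₁ σ))
    (hφ₂ : ContinuousOn φ₂ (Iic (-S))) (hψ₂ : ContinuousOn ψ₂ (Iic (-S)))
    (hb₂ : ∃ K : ℝ, ∀ s ∈ Iic (-S), |φ₂ s| ≤ K ∧ |ψ₂ s| ≤ K)
    (e₂ : ∀ s ∈ Iic (-S), φ₂ s = a + c * ∫ σ in Iic s,
      (Real.exp (2 * σ) - Real.exp (-3 * s + 5 * σ)) * F (Real.exp (2 * σ)) (φ₂ σ) (ψ₂ σ))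
    (f₂ : ∀ s ∈ Iic (-S), ψ₂ s = b + d * ∫ σ in Iic s,
      (Real.exp (2 * σ) - Real.exp (-3 * s + 5 * σ)) * G (Real.exp (2 * σ)) (φ₂ σ) (ψ₂ σ)) :
    EqOn φ₁ φ₂ (Iic (-S)) ∧ EqOn ψ₁ ψ₂ (Iic (-S)) := by
  obtain ⟨K₁, hK₁⟩ := hb₁
  obtain ⟨K₂, hK₂⟩ := hb₂
  set K := max K₁ K₂
  have hb₁ : ∀ s ∈ Iic (-S), |φ₁ s| ≤ K ∧ |ψ₁ s| ≤ K := fun s hs =>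
    ⟨(hK₁ s hs).1.trans (le_max_left _ _), (hK₁ s hs).2.trans (le_max_left _ _)⟩
  have hb₂ : ∀ s ∈ Iic (-S), |φ₂ s| ≤ K ∧ |ψ₂ s| ≤ K := fun s hs =>
    ⟨(hK₂ s hs).1.trans (le_max_right _ _), (hK₂ s hs).2.trans (le_max_right _ _)⟩
  obtain ⟨L, hL, hLF⟩ := hF K
  obtain ⟨M, hM, hMG⟩ := hG K
  set C := max L M
  have hK0 : 0 ≤ K := (abs_nonneg _).trans (hb₁ (-S) self_mem_Iic).1
  have hC0 : 0 ≤ C := le_max_of_le_left hL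
  have main : ∀ n : ℕ, ∀ s ∈ Iic (-S), max |φ₁ s - φ₂ s| |ψ₁ s - ψ₂ s|
      ≤ (2 * K) / 2 ^ n * Real.exp (C * Real.exp (2 * s)) := by
    intro n
    induction n with
    | zero =>
      intro s hs
      have h1 : 1 ≤ Real.exp (C * Real.exp (2 * s)) :=
        Real.one_le_exp (mul_nonneg hC0 (Real.exp_pos _).le)
      have h2 : max |φ₁ s - φ₂ s| |ψ₁ s - ψ₂ s| ≤ 2 * K := by
        refine max_le ?_ ?_
        · have := abs_sub (φ₁ s) (φ₂ s); linarith [(hb₁ s hs).1, (hb₂ s hs).1]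
        · have := abs_sub (ψ₁ s) (ψ₂ s); linarith [(hb₁ s hs).2, (hb₂ s hs).2]
      simp only [pow_zero, div_one]
      nlinarith
    | succ n ih =>
      intro s hs
      have hh : 2 * K / 2 ^ (n+1) = 2 * K / 2 ^ n / 2 := by rw [pow_succ, div_div]
      rw [hh]
      refine max_le ?_ ?_
      · rw [e₁ s hs, e₂ s hs]
        exact diff_step S hS F hFc hF0 K L hL hLF C (le_max_left _ _) a c hc φ₁ ψ₁ φ₂ ψ₂
          hφ₁ hψ₁ hφ₂ hψ₂ hb₁ hb₂ _ ih s hs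
      · rw [f₁ s hs, f₂ s hs]
        exact diff_step S hS G hGc hG0 K M hM hMG C (le_max_right _ _) b d hd φ₁ ψ₁ φ₂ ψ₂
          hφ₁ hψ₁ hφ₂ hψ₂ hb₁ hb₂ _ ih s hs
  have fin : ∀ s ∈ Iic (-S), max |φ₁ s - φ₂ s| |ψ₁ s - ψ₂ s| ≤ 0 := by
    intro s hs
    have ht : Tendsto (fun n : ℕ => (2 * K) / 2 ^ n * Real.exp (C * Real.exp (2 * s))) atTop
        (nhds (0 * Real.exp (C * Real.exp (2 * s)))) := by
      refine Tendsto.mul_const _ ?_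
      exact tendsto_const_nhds.div_atTop (tendsto_pow_atTop_atTop_of_one_lt (by norm_num))
    rw [zero_mul] at ht
    exact ge_of_tendsto' ht (fun n => main n s hs)
  refine ⟨fun s hs => ?_, fun s hs => ?_⟩
  · have := (le_max_left _ _).trans (fin s hs)
    exact sub_eq_zero.1 (abs_nonpos_iff.1 this)
  · have := (le_max_right _ _).trans (fin s hs)
    exact sub_eq_zero.1 (abs_nonpos_iff.1 this)

/-- the integral operator after the substitution `σ = s + τ` -/
noncomputable def Jop (h : ℝ → ℝ) (s : ℝ) : ℝ :=
  Real.exp (2 * s) * ∫ τ in Iic (0:ℝ), (Real.exp (2 * τ) - Real.exp (5 * τ)) * h (s + τ)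

lemma kern0 (τ : ℝ) (h : τ ≤ 0) : |Real.exp (2 * τ) - Real.exp (5 * τ)| ≤ Real.exp (2 * τ) := by
  simpa using kern_bound 0 τ h

lemma Jop_eq (h : ℝ → ℝ) (s : ℝ) : Jop h s =
    ∫ σ in Iic s, (Real.exp (2 * σ) - Real.exp (-3 * s + 5 * σ)) * h σ := by
  have hmp : MeasurePreserving (fun τ : ℝ => s + τ) volume volume :=
    measurePreserving_add_left volume s
  have := hmp.setIntegral_preimage_emb (Homeomorph.addLeft s).measurableEmbedding
    (fun σ => (Real.exp (2 * σ) - Real.exp (-3 * s + 5 * σ)) * h σ) (Iic s)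
  rw [← this]
  have hpre : (fun τ : ℝ => s + τ) ⁻¹' Iic s = Iic 0 := by
    ext τ; simp
  rw [hpre, Jop, ← integral_const_mul]
  congr 1
  ext τ
  rw [← mul_assoc, mul_sub, ← Real.exp_add, ← Real.exp_add]
  ring_nf

lemma Jop_congr (h h' : ℝ → ℝ) (s : ℝ) (H : ∀ σ ≤ s, h σ = h' σ) : Jop h s = Jop h' s := by
  unfold Jop
  congr 1
  refine setIntegral_congr_fun measurableSet_Iic (fun τ hτ => ?_)
  have : τ ≤ 0 := hτ
  simp only [H (s + τ) (by linarith)]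

lemma Jop_bound (h : ℝ → ℝ) (s B : ℝ) (hB : ∀ σ, |h σ| ≤ B) :
    |Jop h s| ≤ Real.exp (2 * s) * B := by
  have hB0 : 0 ≤ B := (abs_nonneg _).trans (hB 0)
  rw [Jop, abs_mul, abs_of_pos (Real.exp_pos _)]
  refine mul_le_mul_of_nonneg_left ?_ (Real.exp_pos _).le
  have : ‖∫ τ in Iic (0:ℝ), (Real.exp (2 * τ) - Real.exp (5 * τ)) * h (s + τ)‖ ≤
      ∫ τ in Iic (0:ℝ), Real.exp (2 * τ) * B := by
    refine norm_integral_le_of_norm_le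
      ((integrableOn_exp_mul_Iic (a := 2) (by norm_num) 0).mul_const B) ?_
    refine (ae_restrict_iff' measurableSet_Iic).2 (Eventually.of_forall fun τ hτ => ?_)
    rw [Real.norm_eq_abs, abs_mul]
    exact mul_le_mul (kern0 τ hτ) (hB _) (abs_nonneg _) (Real.exp_pos _).le
  rw [integral_mul_const, integral_exp_mul_Iic (by norm_num)] at this
  simp only [mul_zero, Real.exp_zero, Real.norm_eq_abs] at this
  linarith

lemma Jop_meas (h : ℝ → ℝ) (hc : Continuous h) (s : ℝ) :
    Continuous (fun τ => (Real.exp (2 * τ) - Real.exp (5 * τ)) * h (s + τ)) := by fun_prop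

lemma Jop_integrable (h : ℝ → ℝ) (hc : Continuous h) (s B : ℝ) (hB : ∀ σ, |h σ| ≤ B) :
    IntegrableOn (fun τ => (Real.exp (2 * τ) - Real.exp (5 * τ)) * h (s + τ)) (Iic 0) := by
  refine Integrable.mono' ((integrableOn_exp_mul_Iic (a := 2) (by norm_num) 0).mul_const B)
    (Jop_meas h hc s).aestronglyMeasurable ?_
  refine (ae_restrict_iff' measurableSet_Iic).2 (Eventually.of_forall fun τ hτ => ?_)
  rw [Real.norm_eq_abs, abs_mul]
  exact mul_le_mul (kern0 τ hτ) (hB _) (abs_nonneg _) (Real.exp_pos _).le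

lemma Jop_sub (h h' : ℝ → ℝ) (hc : Continuous h) (hc' : Continuous h') (s B : ℝ)
    (hB : ∀ σ, |h σ| ≤ B) (hB' : ∀ σ, |h' σ| ≤ B) :
    Jop h s - Jop h' s = Jop (fun σ => h σ - h' σ) s := by
  unfold Jop
  rw [← mul_sub, ← integral_sub (Jop_integrable h hc s B hB) (Jop_integrable h' hc' s B hB')]
  simp only [mul_sub]

lemma Jop_cont (h : ℝ → ℝ) (hc : Continuous h) (B : ℝ) (hB : ∀ σ, |h σ| ≤ B) :
    Continuous (Jop h) := by
  unfold Jop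
  refine Continuous.mul (by fun_prop) ?_
  refine continuous_of_dominated (bound := fun τ => Real.exp (2 * τ) * B)
    (fun s => (Jop_meas h hc s).aestronglyMeasurable) (fun s => ?_)
    ((integrableOn_exp_mul_Iic (a := 2) (by norm_num) 0).mul_const B)
    (Eventually.of_forall fun τ => by fun_prop)
  refine (ae_restrict_iff' measurableSet_Iic).2 (Eventually.of_forall fun τ hτ => ?_)
  rw [Real.norm_eq_abs, abs_mul]
  exact mul_le_mul (kern0 τ hτ) (hB _) (abs_nonneg _) (Real.exp_pos _).le

/-- truncation to `[-R, R]` -/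
def clampR (R x : ℝ) : ℝ := max (min x R) (-R)

lemma clampR_cont (R : ℝ) : Continuous (clampR R) := by unfold clampR; fun_prop

lemma clampR_abs (R x : ℝ) (hR : 0 ≤ R) : |clampR R x| ≤ R :=
  abs_le.2 ⟨le_max_right _ _, max_le (min_le_right _ _) (by linarith)⟩

lemma clampR_of_abs_le (R x : ℝ) (h : |x| ≤ R) : clampR R x = x := by
  rw [clampR, min_eq_left (abs_le.1 h).2, max_eq_left (abs_le.1 h).1]

lemma clampR_lip (R x y : ℝ) : |clampR R x - clampR R y| ≤ |x - y| := by
  refine (abs_max_sub_max_le_abs _ _ _).trans ?_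
  have := abs_min_sub_min_le_max x R y R
  simpa using this

/-- the truncated nonlinearity along `u` -/
noncomputable def trunc (F : ℝ → ℝ → ℝ → ℝ) (R : ℝ) (u : ℝ → ℝ × ℝ) (σ : ℝ) : ℝ :=
  F (Real.exp (2 * min σ 0)) (clampR R (u σ).1) (clampR R (u σ).2)

lemma trunc_cont (F : ℝ → ℝ → ℝ → ℝ)
    (hFc : Continuous (fun p : ℝ × ℝ × ℝ => F p.1 p.2.1 p.2.2)) (R : ℝ) (u : ℝ → ℝ × ℝ)
    (hu : Continuous u) : Continuous (trunc F R u) := by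
  have h := clampR_cont R
  exact hFc.comp (f := fun σ => (Real.exp (2 * min σ 0), clampR R (u σ).1, clampR R (u σ).2))
    (by fun_prop)

lemma trunc_lip (F : ℝ → ℝ → ℝ → ℝ) (R L : ℝ) (hR : 0 ≤ R) (hL : 0 ≤ L)
    (hLip : ∀ e x y x' y' : ℝ, 0 ≤ e → e ≤ 1 → |x| ≤ R → |y| ≤ R →
      |x'| ≤ R → |y'| ≤ R → |F e x y - F e x' y'| ≤ L * max |x - x'| |y - y'|)
    (u v : ℝ → ℝ × ℝ) (σ : ℝ) : |trunc F R u σ - trunc F R v σ| ≤ L * dist (u σ) (v σ) := by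
  refine (hLip _ _ _ _ _ (Real.exp_pos _).le (Real.exp_le_one_iff.2 ?_) (clampR_abs _ _ hR)
    (clampR_abs _ _ hR) (clampR_abs _ _ hR) (clampR_abs _ _ hR)).trans ?_
  · have := min_le_right σ 0; linarith
  · refine mul_le_mul_of_nonneg_left ?_ hL
    rw [Prod.dist_eq, Real.dist_eq, Real.dist_eq]
    exact max_le_max (clampR_lip _ _ _) (clampR_lip _ _ _)

lemma trunc_bound (F : ℝ → ℝ → ℝ → ℝ) (hF0 : ∀ e, F e 0 0 = 0) (R L : ℝ) (hR : 0 ≤ R) (hL : 0 ≤ L)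
    (hLip : ∀ e x y x' y' : ℝ, 0 ≤ e → e ≤ 1 → |x| ≤ R → |y| ≤ R →
      |x'| ≤ R → |y'| ≤ R → |F e x y - F e x' y'| ≤ L * max |x - x'| |y - y'|)
    (u : ℝ → ℝ × ℝ) (σ : ℝ) : |trunc F R u σ| ≤ L * R := by
  have := hLip (Real.exp (2 * min σ 0)) (clampR R (u σ).1) (clampR R (u σ).2) 0 0
    (Real.exp_pos _).le (Real.exp_le_one_iff.2 (by have := min_le_right σ 0; linarith))
    (clampR_abs _ _ hR) (clampR_abs _ _ hR) (by simpa) (by simpa)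
  rw [hF0] at this
  simp only [sub_zero] at this
  exact this.trans (mul_le_mul_of_nonneg_left
    (max_le (clampR_abs _ _ hR) (clampR_abs _ _ hR)) hL)

open BoundedContinuousFunction in
lemma exist (F G : ℝ → ℝ → ℝ → ℝ)
    (hFc : Continuous (fun p : ℝ × ℝ × ℝ => F p.1 p.2.1 p.2.2)) (hF0 : ∀ e, F e 0 0 = 0)
    (hGc : Continuous (fun p : ℝ × ℝ × ℝ => G p.1 p.2.1 p.2.2)) (hG0 : ∀ e, G e 0 0 = 0)
    (hF : LipH F) (hG : LipH G) (a b c d : ℝ) (hc : |c| ≤ 1) (hd : |d| ≤ 1) :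
    ∃ S > (0:ℝ), ∃ φ ψ : ℝ → ℝ, ContinuousOn φ (Iic (-S)) ∧ ContinuousOn ψ (Iic (-S)) ∧
    (∃ K : ℝ, ∀ s ∈ Iic (-S), |φ s| ≤ K ∧ |ψ s| ≤ K) ∧
    (∀ s ∈ Iic (-S), φ s = a + c * ∫ σ in Iic s,
      (Real.exp (2 * σ) - Real.exp (-3 * s + 5 * σ)) * F (Real.exp (2 * σ)) (φ σ) (ψ σ)) ∧
    (∀ s ∈ Iic (-S), ψ s = b + d * ∫ σ in Iic s,
      (Real.exp (2 * σ) - Real.exp (-3 * s + 5 * σ)) * G (Real.exp (2 * σ)) (φ σ) (ψ σ)) ∧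
    Tendsto φ atBot (nhds a) ∧ Tendsto ψ atBot (nhds b) := by
  set R := |a| + |b| + 1 with hRdef
  have ha := abs_nonneg a
  have hb := abs_nonneg b
  have hR : 0 ≤ R := by linarith
  obtain ⟨L₁, hL₁, hLF'⟩ := hF R
  obtain ⟨L₂, hL₂, hLG'⟩ := hG R
  set L := max L₁ L₂
  have hL : 0 ≤ L := le_max_of_le_left hL₁
  have hLF : ∀ e x y x' y' : ℝ, 0 ≤ e → e ≤ 1 → |x| ≤ R → |y| ≤ R →
      |x'| ≤ R → |y'| ≤ R → |F e x y - F e x' y'| ≤ L * max |x - x'| |y - y'| :=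
    fun e x y x' y' h1 h2 h3 h4 h5 h6 => (hLF' e x y x' y' h1 h2 h3 h4 h5 h6).trans
      (mul_le_mul_of_nonneg_right (le_max_left _ _) (le_max_of_le_left (abs_nonneg _)))
  have hLG : ∀ e x y x' y' : ℝ, 0 ≤ e → e ≤ 1 → |x| ≤ R → |y| ≤ R →
      |x'| ≤ R → |y'| ≤ R → |G e x y - G e x' y'| ≤ L * max |x - x'| |y - y'| :=
    fun e x y x' y' h1 h2 h3 h4 h5 h6 => (hLG' e x y x' y' h1 h2 h3 h4 h5 h6).trans
      (mul_le_mul_of_nonneg_right (le_max_right _ _) (le_max_of_le_left (abs_nonneg _)))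
  clear hLF' hLG'
  have hLR : 0 ≤ L * R := mul_nonneg hL hR
  set S := L + L * R + 1 with hSdef
  have hS : 0 < S := by linarith
  have hexp : Real.exp (2 * -S) * S ≤ 1 / 2 := by
    have h1 := Real.add_one_le_exp (2 * S)
    have h2 : Real.exp (2 * -S) * Real.exp (2 * S) = 1 := by
      rw [← Real.exp_add]; simp
    have h3 := Real.exp_pos (2 * -S)
    nlinarith
  have hexpm : ∀ s, s ≤ -S → ∀ B, 0 ≤ B → B ≤ S → Real.exp (2 * s) * B ≤ 1 / 2 := by
    intro s hs B hB0 hB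
    refine le_trans ?_ hexp
    exact mul_le_mul (Real.exp_le_exp.2 (by linarith)) hB hB0 (Real.exp_pos _).le
  have comp : ∀ (H : ℝ → ℝ → ℝ → ℝ) (_ : ∀ e, H e 0 0 = 0) (_ : ∀ e x y x' y' : ℝ, 0 ≤ e → e ≤ 1 →
      |x| ≤ R → |y| ≤ R → |x'| ≤ R → |y'| ≤ R →
      |H e x y - H e x' y'| ≤ L * max |x - x'| |y - y'|) (a c : ℝ) (_ : |c| ≤ 1) (_ : |a| + 1 ≤ R)
      (u : ℝ → ℝ × ℝ) (s : ℝ),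
      |a + c * Jop (trunc H R u) (min s (-S))| ≤ R := by
    intro H hH0 hLH a c hc haR u s
    have h1 := Jop_bound (trunc H R u) (min s (-S)) (L * R) (trunc_bound H hH0 R L hR hL hLH u)
    have h2 := hexpm (min s (-S)) (min_le_right _ _) (L * R) hLR (by linarith)
    have h3 : |c * Jop (trunc H R u) (min s (-S))| ≤ 1 := by
      rw [abs_mul]
      nlinarith [abs_nonneg c, abs_nonneg (Jop (trunc H R u) (min s (-S)))]
    have := abs_add_le a (c * Jop (trunc H R u) (min s (-S)))
    linarith
  have hTc : ∀ u : ℝ →ᵇ ℝ × ℝ, Continuous (fun s : ℝ =>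
      (a + c * Jop (trunc F R u) (min s (-S)), b + d * Jop (trunc G R u) (min s (-S)))) := by
    intro u
    have h1 := Jop_cont (trunc F R u) (trunc_cont F hFc R u u.continuous) (L * R)
      (trunc_bound F hF0 R L hR hL hLF u)
    have h2 := Jop_cont (trunc G R u) (trunc_cont G hGc R u u.continuous) (L * R)
      (trunc_bound G hG0 R L hR hL hLG u)
    fun_prop
  let T : (ℝ →ᵇ ℝ × ℝ) → (ℝ →ᵇ ℝ × ℝ) := fun u =>
    BoundedContinuousFunction.ofNormedAddCommGroup _ (hTc u) R (by
      intro s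
      rw [Prod.norm_def]
      exact max_le (comp F hF0 hLF a c hc (by linarith) u s)
        (comp G hG0 hLG b d hd (by linarith) u s))
  have cdiff : ∀ (H : ℝ → ℝ → ℝ → ℝ)
      (_ : Continuous (fun p : ℝ × ℝ × ℝ => H p.1 p.2.1 p.2.2)) (_ : ∀ e, H e 0 0 = 0)
      (_ : ∀ e x y x' y' : ℝ, 0 ≤ e → e ≤ 1 →
      |x| ≤ R → |y| ≤ R → |x'| ≤ R → |y'| ≤ R →
      |H e x y - H e x' y'| ≤ L * max |x - x'| |y - y'|) (a c : ℝ) (_ : |c| ≤ 1)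
      (u v : ℝ →ᵇ ℝ × ℝ) (s : ℝ),
      dist (a + c * Jop (trunc H R u) (min s (-S))) (a + c * Jop (trunc H R v) (min s (-S)))
        ≤ 1 / 2 * dist u v := by
    intro H hHc hH0 hLH a c hc u v s
    have h1 := Jop_sub (trunc H R u) (trunc H R v) (trunc_cont H hHc R u u.continuous)
      (trunc_cont H hHc R v v.continuous) (min s (-S)) (L * R)
      (trunc_bound H hH0 R L hR hL hLH u) (trunc_bound H hH0 R L hR hL hLH v)
    have h2 := Jop_bound (fun σ => trunc H R u σ - trunc H R v σ) (min s (-S)) (L * dist u v)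
      (fun σ => (trunc_lip H R L hR hL hLH u v σ).trans
        (mul_le_mul_of_nonneg_left (BoundedContinuousFunction.dist_coe_le_dist σ) hL))
    have h3 := hexpm (min s (-S)) (min_le_right _ _) L hL (by linarith)
    rw [Real.dist_eq, add_sub_add_left_eq_sub, ← mul_sub, h1, abs_mul]
    calc _ ≤ 1 * _ := mul_le_mul_of_nonneg_right hc (abs_nonneg _)
      _ ≤ 1 * _ := mul_le_mul_of_nonneg_left h2 zero_le_one
      _ = (Real.exp (2 * min s (-S)) * L) * dist u v := by ring
      _ ≤ _ := mul_le_mul_of_nonneg_right h3 dist_nonneg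
  have hT : ContractingWith (1/2) T := by
    refine ⟨by rw [← NNReal.coe_lt_coe]; norm_num, LipschitzWith.of_dist_le_mul fun u v => ?_⟩
    refine (BoundedContinuousFunction.dist_le (by positivity)).2 fun s => ?_
    have hhalf : ((1 / 2 : NNReal) : ℝ) = 1 / 2 := by norm_num
    rw [Prod.dist_eq, hhalf]
    refine max_le ?_ ?_
    · exact cdiff F hFc hF0 hLF a c hc u v s
    · exact cdiff G hGc hG0 hLG b d hd u v s
  obtain ⟨u, hu⟩ : ∃ u, T u = u := ⟨_, hT.fixedPoint_isFixedPt⟩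
  have hu1 : ∀ s, (u s).1 = a + c * Jop (trunc F R u) (min s (-S)) := fun s => by
    conv_lhs => rw [← hu]
    rfl
  have hu2 : ∀ s, (u s).2 = b + d * Jop (trunc G R u) (min s (-S)) := fun s => by
    conv_lhs => rw [← hu]
    rfl
  have hb1 : ∀ s, |(u s).1| ≤ R := fun s => by
    rw [hu1]; exact comp F hF0 hLF a c hc (by linarith) u s
  have hb2 : ∀ s, |(u s).2| ≤ R := fun s => by
    rw [hu2]; exact comp G hG0 hLG b d hd (by linarith) u s
  have htr : ∀ (H : ℝ → ℝ → ℝ → ℝ) (s : ℝ), s ≤ -S → Jop (trunc H R u) (min s (-S)) =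
      ∫ σ in Iic s, (Real.exp (2 * σ) - Real.exp (-3 * s + 5 * σ)) *
        H (Real.exp (2 * σ)) (u σ).1 (u σ).2 := by
    intro H s hs
    rw [min_eq_left hs, ← Jop_eq (fun σ => H (Real.exp (2 * σ)) (u σ).1 (u σ).2)]
    refine Jop_congr _ _ _ fun σ hσ => ?_
    rw [trunc, min_eq_left (by linarith), clampR_of_abs_le _ _ (hb1 σ),
      clampR_of_abs_le _ _ (hb2 σ)]
  have htend : ∀ (H : ℝ → ℝ → ℝ → ℝ) (_ : ∀ e, H e 0 0 = 0)
      (_ : ∀ e x y x' y' : ℝ, 0 ≤ e → e ≤ 1 →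
      |x| ≤ R → |y| ≤ R → |x'| ≤ R → |y'| ≤ R →
      |H e x y - H e x' y'| ≤ L * max |x - x'| |y - y'|) (a c : ℝ),
      Tendsto (fun s => a + c * Jop (trunc H R u) (min s (-S))) atBot (nhds a) := by
    intro H hH0 hLH a c
    have h1 : Tendsto (fun s => Jop (trunc H R u) (min s (-S))) atBot (nhds 0) := by
      have h0 : Tendsto (fun s : ℝ => Real.exp (2 * s) * (L * R)) atBot (nhds (0 * (L * R))) :=
        Tendsto.mul_const _
          (Real.tendsto_exp_atBot.comp (tendsto_id.const_mul_atBot (by norm_num)))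
      rw [zero_mul] at h0
      refine squeeze_zero_norm (fun s => ?_) h0
      have h1 := Jop_bound (trunc H R u) (min s (-S)) (L * R)
        (trunc_bound H hH0 R L hR hL hLH u)
      rw [Real.norm_eq_abs]
      refine h1.trans (mul_le_mul_of_nonneg_right (Real.exp_le_exp.2 ?_) hLR)
      have := min_le_left s (-S)
      linarith
    simpa using (h1.const_mul c).const_add a
  refine ⟨S, hS, fun s => (u s).1, fun s => (u s).2, ?_, ?_, ⟨R, fun s _ => ⟨hb1 s, hb2 s⟩⟩,
    ?_, ?_, ?_, ?_⟩
  · exact (continuous_fst.comp u.continuous).continuousOn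
  · exact (continuous_snd.comp u.continuous).continuousOn
  · intro s hs
    rw [← htr F s hs]; exact hu1 s
  · intro s hs
    rw [← htr G s hs]; exact hu2 s
  · simp only [hu1]; exact htend F hF0 hLF a c
  · simp only [hu2]; exact htend G hG0 hLG b d

theorem stmt14 (α β g₀ lam ρ₀ : ℝ) (hg : 0 < g₀) (hlam : 0 < lam) (hρ₀ : 0 < ρ₀) :
    ∃ S > (0 : ℝ),
      (∃ φ ψ : ℝ → ℝ,
        ContinuousOn φ (Iic (-S)) ∧ ContinuousOn ψ (Iic (-S)) ∧
        (∃ K : ℝ, ∀ s ∈ Iic (-S), |φ s| ≤ K ∧ |ψ s| ≤ K) ∧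
        (∀ s ∈ Iic (-S), φ s = -α + (1 / 3) *
          ∫ σ in Iic s, (Real.exp (2 * σ) - Real.exp (-3 * s + 5 * σ)) *
            (3 * (φ σ) ^ 2 + Real.exp (2 * σ) * (φ σ) ^ 3
              + g₀ ^ 2 * Real.exp (2 * σ) * (ψ σ) ^ 2 * φ σ)) ∧
        (∀ s ∈ Iic (-S), ψ s = β + (1 / 2) *
          ∫ σ in Iic s, (Real.exp (2 * σ) - Real.exp (-3 * s + 5 * σ)) *
            (2 * (2 * φ σ + Real.exp (2 * σ) * (φ σ) ^ 2) * ψ σ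
              + lam * (Real.exp (2 * σ) * (ψ σ) ^ 2 - ρ₀ ^ 2) * ψ σ)) ∧
        Tendsto φ atBot (nhds (-α)) ∧ Tendsto ψ atBot (nhds β)) ∧
      (∀ φ₁ ψ₁ φ₂ ψ₂ : ℝ → ℝ,
        (ContinuousOn φ₁ (Iic (-S)) ∧ ContinuousOn ψ₁ (Iic (-S)) ∧
          (∃ K : ℝ, ∀ s ∈ Iic (-S), |φ₁ s| ≤ K ∧ |ψ₁ s| ≤ K) ∧
          (∀ s ∈ Iic (-S), φ₁ s = -α + (1 / 3) *
            ∫ σ in Iic s, (Real.exp (2 * σ) - Real.exp (-3 * s + 5 * σ)) *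
              (3 * (φ₁ σ) ^ 2 + Real.exp (2 * σ) * (φ₁ σ) ^ 3
                + g₀ ^ 2 * Real.exp (2 * σ) * (ψ₁ σ) ^ 2 * φ₁ σ)) ∧
          (∀ s ∈ Iic (-S), ψ₁ s = β + (1 / 2) *
            ∫ σ in Iic s, (Real.exp (2 * σ) - Real.exp (-3 * s + 5 * σ)) *
              (2 * (2 * φ₁ σ + Real.exp (2 * σ) * (φ₁ σ) ^ 2) * ψ₁ σ
                + lam * (Real.exp (2 * σ) * (ψ₁ σ) ^ 2 - ρ₀ ^ 2) * ψ₁ σ))) →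
        (ContinuousOn φ₂ (Iic (-S)) ∧ ContinuousOn ψ₂ (Iic (-S)) ∧
          (∃ K : ℝ, ∀ s ∈ Iic (-S), |φ₂ s| ≤ K ∧ |ψ₂ s| ≤ K) ∧
          (∀ s ∈ Iic (-S), φ₂ s = -α + (1 / 3) *
            ∫ σ in Iic s, (Real.exp (2 * σ) - Real.exp (-3 * s + 5 * σ)) *
              (3 * (φ₂ σ) ^ 2 + Real.exp (2 * σ) * (φ₂ σ) ^ 3
                + g₀ ^ 2 * Real.exp (2 * σ) * (ψ₂ σ) ^ 2 * φ₂ σ)) ∧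
          (∀ s ∈ Iic (-S), ψ₂ s = β + (1 / 2) *
            ∫ σ in Iic s, (Real.exp (2 * σ) - Real.exp (-3 * s + 5 * σ)) *
              (2 * (2 * φ₂ σ + Real.exp (2 * σ) * (φ₂ σ) ^ 2) * ψ₂ σ
                + lam * (Real.exp (2 * σ) * (ψ₂ σ) ^ 2 - ρ₀ ^ 2) * ψ₂ σ))) →
        (EqOn φ₁ φ₂ (Iic (-S)) ∧ EqOn ψ₁ ψ₂ (Iic (-S)))) := by
  let F : ℝ → ℝ → ℝ → ℝ := fun e x y => 3 * x ^ 2 + e * x ^ 3 + g₀ ^ 2 * e * y ^ 2 * x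
  let G : ℝ → ℝ → ℝ → ℝ := fun e x y =>
    2 * (2 * x + e * x ^ 2) * y + lam * (e * y ^ 2 - ρ₀ ^ 2) * y
  have hF : ContDiff ℝ 1 (fun p : ℝ × ℝ × ℝ => F p.1 p.2.1 p.2.2) := by
    simp only [F]; fun_prop
  have hG : ContDiff ℝ 1 (fun p : ℝ × ℝ × ℝ => G p.1 p.2.1 p.2.2) := by
    simp only [G]; fun_prop
  have hF0 : ∀ e, F e 0 0 = 0 := fun e => by simp [F]
  have hG0 : ∀ e, G e 0 0 = 0 := fun e => by simp [G]
  have hc : |(1 / 3 : ℝ)| ≤ 1 := by rw [abs_of_pos] <;> norm_num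
  have hd : |(1 / 2 : ℝ)| ≤ 1 := by rw [abs_of_pos] <;> norm_num
  obtain ⟨S, hS, hex⟩ := exist F G hF.continuous hF0 hG.continuous hG0 (lipH_of_contDiff F hF)
    (lipH_of_contDiff G hG) (-α) β (1 / 3) (1 / 2) hc hd
  refine ⟨S, hS, hex, ?_⟩
  rintro φ₁ ψ₁ φ₂ ψ₂ ⟨h1, h2, h3, h4, h5⟩ ⟨k1, k2, k3, k4, k5⟩
  exact uniq S hS F G hF.continuous hF0 hG.continuous hG0 (lipH_of_contDiff F hF)
    (lipH_of_contDiff G hG) (-α) β (1 / 3) (1 / 2) hc hd φ₁ ψ₁ φ₂ ψ₂ h1 h2 h3 h4 h5 k1 k2 k3 k4 k5
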